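/- arXiv:1903.07881 — 4 statements merged into one kernel-verified Lean document; each statement's English description precedes it below -/
import Mathlib

section
/- Let V and W be finite-dimensional real vector spaces and let A : V → W be a surjective linear map. Then a tensor T ∈ V ⊗ W lies in the image under id_V ⊗ A of the subspace of flip-fixed tensors of V ⊗ V if and only if (A ⊗ id_W)(T) ∈ W ⊗ W is fixed by the flip map of W ⊗ W. -/
open scoped TensorProduct

/-- The subspace of `U ⊗ U` consisting of tensors fixed by the flip map `a ⊗ b ↦ b ⊗ a`. -/
noncomputable def flipFixed (U : Type*) [AddCommGroup U] [Module ℝ U] :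
    Submodule ℝ (U ⊗[ℝ] U) :=
  LinearMap.ker ((TensorProduct.comm ℝ U U).toLinearMap - LinearMap.id)

theorem mem_flipFixed {U : Type*} [AddCommGroup U] [Module ℝ U] {t : U ⊗[ℝ] U} :
    t ∈ flipFixed U ↔ TensorProduct.comm ℝ U U t = t := by
  simp [flipFixed, sub_eq_zero]

/-- For a surjective linear map `A : V → W` between finite-dimensional real vector spaces,
a tensor `T ∈ V ⊗ W` lies in the image under `id_V ⊗ A` of the flip-fixed tensors of
`V ⊗ V` if and only if `(A ⊗ id_W) T` is fixed by the flip map of `W ⊗ W`. -/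
theorem mem_image_symmetric_iff
    (V W : Type*) [AddCommGroup V] [Module ℝ V] [FiniteDimensional ℝ V]
    [AddCommGroup W] [Module ℝ W] [FiniteDimensional ℝ W]
    (A : V →ₗ[ℝ] W) (hA : Function.Surjective A) (T : V ⊗[ℝ] W) :
    T ∈ Submodule.map (LinearMap.lTensor V A) (flipFixed V) ↔
      LinearMap.rTensor W A T ∈ flipFixed W := by
  constructor
  · rintro ⟨S, hS, rfl⟩
    have hS : TensorProduct.comm ℝ V V S = S := mem_flipFixed.1 hS
    rw [mem_flipFixed, ← LinearMap.comp_apply, LinearMap.rTensor_comp_lTensor,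
      ← TensorProduct.map_comm, hS]
  · intro hT
    rw [mem_flipFixed] at hT
    obtain ⟨B, hB⟩ := A.exists_rightInverse_of_surjective (LinearMap.range_eq_top.2 hA)
    set Y := LinearMap.rTensor W A T with hY
    refine ⟨LinearMap.lTensor V B T + TensorProduct.comm ℝ V V (LinearMap.lTensor V B T) -
      TensorProduct.map B B Y, ?_, ?_⟩
    · refine mem_flipFixed.2 ?_
      rw [map_sub, map_add, TensorProduct.comm_comm, ← TensorProduct.map_comm, hT]
      abel
    · have h₁ : LinearMap.lTensor V A (LinearMap.lTensor V B T) = T := by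
        rw [← LinearMap.lTensor_comp_apply, hB, LinearMap.lTensor_id_apply]
      have h₂ : LinearMap.lTensor V A (TensorProduct.comm ℝ V V (LinearMap.lTensor V B T)) =
          LinearMap.rTensor W B Y := by
        rw [LinearMap.lTensor_comm, ← LinearMap.comp_apply, LinearMap.rTensor_comp_lTensor,
          ← LinearMap.lTensor_comp_rTensor, LinearMap.comp_apply, ← hY,
          ← LinearMap.rTensor_comm, hT]
      have h₃ : LinearMap.lTensor V A (TensorProduct.map B B Y) = LinearMap.rTensor W B Y := by
        rw [← LinearMap.comp_apply, LinearMap.lTensor_comp_map, hB, LinearMap.rTensor_def]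
      rw [map_sub, map_add, h₁, h₂, h₃, add_sub_cancel_right]
end

section
/- Let V and W be finite-dimensional real vector spaces, let A : V → W be a surjective linear map, and let w = dim W. Then the quotient of V ⊗ W by the image under id_V ⊗ A of the subspace of flip-fixed tensors of V ⊗ V has dimension w(w−1)/2 (the dimension of the second exterior power of W). -/
open scoped TensorProduct

open Module

/-- The trace of the flip map of `W ⊗ W` is `dim W`. -/
theorem trace_tensorProduct_comm (W : Type*) [AddCommGroup W] [Module ℝ W]
    [FiniteDimensional ℝ W] :
    LinearMap.trace ℝ (W ⊗[ℝ] W) (TensorProduct.comm ℝ W W).toLinearMap = finrank ℝ W := by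
  classical
  let b := finBasis ℝ W
  rw [LinearMap.trace_eq_matrix_trace ℝ (b.tensorProduct b), Matrix.trace,
    Fintype.sum_prod_type]
  simp [LinearMap.toMatrix_apply, Finsupp.single_apply, ← ite_and, eq_comm]

/-- The image of `flip - id` on `W ⊗ W` has the dimension of the second exterior power of `W`. -/
theorem finrank_range_comm_sub_id (W : Type*) [AddCommGroup W] [Module ℝ W]
    [FiniteDimensional ℝ W] :
    finrank ℝ (LinearMap.range ((TensorProduct.comm ℝ W W).toLinearMap - LinearMap.id)) =
      finrank ℝ W * (finrank ℝ W - 1) / 2 := by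
  set τ : W ⊗[ℝ] W →ₗ[ℝ] W ⊗[ℝ] W := (TensorProduct.comm ℝ W W).toLinearMap with hτ
  have hττ (x : W ⊗[ℝ] W) : τ (τ x) = x := by simp [τ]
  have hproj : LinearMap.IsProj (LinearMap.range (τ - LinearMap.id))
      ((-1 / 2 : ℝ) • (τ - LinearMap.id)) := by
    refine ⟨fun x ↦ Submodule.smul_mem _ _ ⟨x, rfl⟩, ?_⟩
    rintro _ ⟨x, rfl⟩
    simp only [LinearMap.smul_apply, LinearMap.sub_apply, LinearMap.id_apply, map_sub, hττ]
    module
  have htrace := hproj.trace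
  rw [map_smul, map_sub, hτ, trace_tensorProduct_comm, LinearMap.trace_id,
    finrank_tensorProduct, ← hτ, smul_eq_mul] at htrace
  symm
  apply Nat.div_eq_of_eq_mul_left two_pos
  rcases Nat.eq_zero_or_pos (finrank ℝ W) with h | h
  · rw [h] at htrace ⊢
    simpa using htrace.symm
  · have : (((finrank ℝ W) * (finrank ℝ W - 1) : ℕ) : ℝ) =
        ((finrank ℝ (LinearMap.range (τ - LinearMap.id)) * 2 : ℕ) : ℝ) := by
      push_cast [Nat.cast_sub h] at htrace ⊢
      linarith
    exact_mod_cast this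

/-- For a surjection `A`, the image of the symmetric tensors under `id ⊗ A` consists of
the tensors which become symmetric after applying `A ⊗ id`. -/
theorem map_lTensor_flipFixed {V W : Type*} [AddCommGroup V] [Module ℝ V] [AddCommGroup W]
    [Module ℝ W] (A : V →ₗ[ℝ] W) (hA : Function.Surjective A) :
    Submodule.map (LinearMap.lTensor V A) (flipFixed V) =
      LinearMap.ker (((TensorProduct.comm ℝ W W).toLinearMap - LinearMap.id) ∘ₗ
        LinearMap.rTensor W A) := by
  obtain ⟨s, hs⟩ := A.exists_rightInverse_of_surjective (LinearMap.range_eq_top.2 hA)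
  have hs' (w : W) : A (s w) = w := LinearMap.congr_fun hs w
  ext x
  constructor
  · rintro ⟨y, hy, rfl⟩
    have hy' : TensorProduct.comm ℝ V V y = y := sub_eq_zero.1 hy
    have key : (TensorProduct.comm ℝ W W).toLinearMap ∘ₗ A.rTensor W ∘ₗ A.lTensor V =
        A.rTensor W ∘ₗ A.lTensor V ∘ₗ (TensorProduct.comm ℝ V V).toLinearMap := by
      ext a b
      simp
    replace key := LinearMap.congr_fun key y
    simp only [LinearMap.comp_apply, LinearEquiv.coe_coe, hy'] at key
    exact sub_eq_zero.2 key
  · intro hx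
    have hx' : TensorProduct.comm ℝ W W (A.rTensor W x) = A.rTensor W x := sub_eq_zero.1 hx
    let σ := (TensorProduct.comm ℝ V V).toLinearMap
    let y := s.lTensor V x
    let z := TensorProduct.map s s (A.rTensor W x)
    have hσz : σ z = z := by
      have h : σ ∘ₗ TensorProduct.map s s =
          TensorProduct.map s s ∘ₗ (TensorProduct.comm ℝ W W).toLinearMap := by
        ext a b
        simp [σ]
      simpa [z, hx'] using LinearMap.congr_fun h (A.rTensor W x)
    have hAy : A.lTensor V y = x := by
      have h : A.lTensor V ∘ₗ s.lTensor V = LinearMap.id := by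
        rw [← LinearMap.lTensor_comp, hs, LinearMap.lTensor_id]
      exact LinearMap.congr_fun h x
    have hAσy : A.lTensor V (σ y) = A.lTensor V z := by
      have h : A.lTensor V ∘ₗ σ ∘ₗ s.lTensor V =
          s.rTensor W ∘ₗ (TensorProduct.comm ℝ W W).toLinearMap ∘ₗ A.rTensor W := by
        ext a b
        simp [σ]
      have h' : A.lTensor V ∘ₗ TensorProduct.map s s = s.rTensor W := by
        ext a b
        simp [hs']
      have hl := LinearMap.congr_fun h x
      have hr := LinearMap.congr_fun h' (A.rTensor W x)
      simp only [LinearMap.comp_apply, LinearEquiv.coe_coe, hx'] at hl hr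
      exact hl.trans hr.symm
    refine ⟨y + σ y - z, sub_eq_zero.2 ?_, ?_⟩
    · have hσσ : σ (σ y) = y := by simp [σ]
      change σ (y + σ y - z) = y + σ y - z
      rw [map_sub, map_add, hσσ, hσz, add_comm]
    · rw [map_sub, map_add, hAy, hAσy, add_sub_cancel_right]

/-- For a surjective linear map `A : V → W` between finite-dimensional real vector spaces
with `w = dim W`, the quotient of `V ⊗ W` by the image under `id_V ⊗ A` of the flip-fixed
tensors of `V ⊗ V` has dimension `w (w - 1) / 2`, the dimension of `Λ² W`. -/
theorem finrank_coker_symmetric_image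
    (V W : Type*) [AddCommGroup V] [Module ℝ V] [FiniteDimensional ℝ V]
    [AddCommGroup W] [Module ℝ W] [FiniteDimensional ℝ W]
    (A : V →ₗ[ℝ] W) (hA : Function.Surjective A) (w : ℕ) (hw : w = Module.finrank ℝ W) :
    Module.finrank ℝ
        ((V ⊗[ℝ] W) ⧸ Submodule.map (LinearMap.lTensor V A) (flipFixed V)) =
      w * (w - 1) / 2 := by
  subst hw
  rw [map_lTensor_flipFixed A hA, (LinearMap.quotKerEquivRange _).finrank_eq,
    LinearMap.range_comp_of_range_eq_top _
      (LinearMap.range_eq_top.2 (LinearMap.rTensor_surjective W hA)),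
    finrank_range_comm_sub_id]
end

section
/- Let m > n ≥ 1. Let φ : ℝ^m → ℝ^n be projection onto the first n coordinates. Let Ṽ : ℝ^n → ℝ and Z = (Z^1, …, Z^n) : ℝ^n → ℝ^n be continuously differentiable, and define W : ℝ^n → ℝ by W(y) = Σ_{q=1}^n ∂_q Ṽ(y) Z^q(y). Let Γ^p_q : ℝ^m → ℝ (for p = n+1, …, m and q = 1, …, n) be continuous functions, and let V : ℝ^m → ℝ be continuously differentiable and satisfy, for every q ∈ {1, …, n} and every x ∈ ℝ^m, ∂_q V(x) + Σ_{p=n+1}^m Γ^p_q(x) ∂_p V(x) = 0. Define V*(x) = Ṽ(φ(x)) + V(x) and the vector field T : ℝ^m → ℝ^m by T^q(x) = Z^q(φ(x)) − ∂_q V*(x) for q ≤ n and T^p(x) = Σ_{q=1}^n Γ^p_q(x) Z^q(φ(x)) − ∂_p V*(x) for n < p ≤ m. Then for every x ∈ ℝ^m: Σ_{i=1}^m ∂_i V*(x) T^i(x) = W(φ(x)) − Σ_{i=1}^m (∂_i V*(x))². -/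
/-- The partial derivative `∂_i f` of `f : ℝ^k → ℝ` with respect to the `i`-th coordinate. -/
noncomputable def pd {k : ℕ} (f : (Fin k → ℝ) → ℝ) (i : Fin k) (x : Fin k → ℝ) : ℝ :=
  fderiv ℝ f x (Pi.single i 1)

/-- Partial derivatives of `f ∘ L + g` for a continuous linear map `L`. -/
theorem pd_comp_clm_add {k l : ℕ} (L : (Fin k → ℝ) →L[ℝ] (Fin l → ℝ))
    {f : (Fin l → ℝ) → ℝ} {g : (Fin k → ℝ) → ℝ} {x : Fin k → ℝ}
    (hf : DifferentiableAt ℝ f (L x)) (hg : DifferentiableAt ℝ g x) (i : Fin k) :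
    pd (fun x => f (L x) + g x) i x = fderiv ℝ f (L x) (L (Pi.single i 1)) + pd g i x := by
  have h := (hf.hasFDerivAt.comp x L.hasFDerivAt).add hg.hasFDerivAt
  change fderiv ℝ (f ∘ L + g) x (Pi.single i 1) = _
  rw [h.fderiv]
  rfl

/-- Derivative of the candidate Lyapunov function `V* = Ṽ ∘ φ + V` along the target
dynamics `T = Σ^target` (horizontal lift of the closed-loop field `Z` minus the gradient
of `V*`): it equals `W ∘ φ − |∇V*|²`, where `W = Σ_q ∂_q Ṽ · Z^q` and the differential of
`V` annihilates the horizontal subbundle of the connection `Γ`. -/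
theorem lyapunov_derivative_along_target
    (m n : ℕ) (hn : 1 ≤ n) (hnm : n < m)
    (φ : (Fin m → ℝ) → (Fin n → ℝ))
    (hφ : ∀ (x : Fin m → ℝ) (q : Fin n), φ x q = x (Fin.castLE hnm.le q))
    (Vt : (Fin n → ℝ) → ℝ) (Z : Fin n → (Fin n → ℝ) → ℝ)
    (hVt : ContDiff ℝ 1 Vt) (hZ : ∀ q, ContDiff ℝ 1 (Z q))
    (W : (Fin n → ℝ) → ℝ)
    (hW : ∀ y : Fin n → ℝ, W y = ∑ q, pd Vt q y * Z q y)
    (Γ : Fin m → Fin n → (Fin m → ℝ) → ℝ)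
    (hΓ : ∀ (p : Fin m) (q : Fin n), n ≤ (p : ℕ) → Continuous (Γ p q))
    (V : (Fin m → ℝ) → ℝ) (hV : ContDiff ℝ 1 V)
    (hVann : ∀ (q : Fin n) (x : Fin m → ℝ),
      pd V (Fin.castLE hnm.le q) x +
        ∑ p ∈ Finset.univ.filter (fun p : Fin m => n ≤ (p : ℕ)), Γ p q x * pd V p x = 0)
    (Vstar : (Fin m → ℝ) → ℝ)
    (hVstar : ∀ x : Fin m → ℝ, Vstar x = Vt (φ x) + V x)
    (T : Fin m → (Fin m → ℝ) → ℝ)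
    (hT : ∀ (i : Fin m) (x : Fin m → ℝ),
      T i x = if h : (i : ℕ) < n then Z ⟨(i : ℕ), h⟩ (φ x) - pd Vstar i x
        else (∑ q, Γ i q x * Z q (φ x)) - pd Vstar i x) :
    ∀ x : Fin m → ℝ,
      ∑ i, pd Vstar i x * T i x = W (φ x) - ∑ i, (pd Vstar i x) ^ 2 := by
  intro x
  obtain ⟨k, rfl⟩ := Nat.exists_eq_add_of_le hnm.le
  let L : (Fin (n + k) → ℝ) →L[ℝ] (Fin n → ℝ) :=
    ContinuousLinearMap.pi fun q => ContinuousLinearMap.proj (Fin.castAdd k q)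
  have hφL : ∀ y, φ y = L y := fun y => funext fun q => hφ y q
  have hVs : Vstar = fun y => Vt (L y) + V y := funext fun y => by rw [hVstar, hφL]
  have hpd : ∀ i, pd Vstar i x = fderiv ℝ Vt (L x) (L (Pi.single i 1)) + pd V i x := fun i => by
    rw [hVs]
    exact pd_comp_clm_add L (hVt.differentiable one_ne_zero _)
      (hV.differentiable one_ne_zero _) i
  have hbase : ∀ q : Fin n, pd Vstar (Fin.castAdd k q) x =
      pd Vt q (φ x) + pd V (Fin.castAdd k q) x := fun q => by
    have hL : L (Pi.single (Fin.castAdd k q) 1) = Pi.single q 1 := by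
      ext r
      simp [L, Pi.single_apply]
    rw [hpd, hL, hφL]
    rfl
  have hfib : ∀ p : Fin k, pd Vstar (Fin.natAdd n p) x = pd V (Fin.natAdd n p) x := fun p => by
    have hL : L (Pi.single (Fin.natAdd n p) 1) = 0 := by
      ext r
      have hne : Fin.castAdd k r ≠ Fin.natAdd n p := by
        simp only [ne_eq, Fin.ext_iff, Fin.val_castAdd, Fin.val_natAdd]
        omega
      simp [L, hne]
    rw [hpd, hL, map_zero, zero_add]
  have hann : ∀ q : Fin n, pd V (Fin.castAdd k q) x =
      -∑ p : Fin k, Γ (Fin.natAdd n p) q x * pd V (Fin.natAdd n p) x := fun q => by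
    have h := hVann q x
    rw [Finset.sum_filter, Fin.sum_univ_add] at h
    simp only [Fin.val_castAdd, Fin.val_natAdd, not_le.mpr (Fin.is_lt _), if_false,
      Finset.sum_const_zero, zero_add, Nat.le_add_right, if_true] at h
    exact eq_neg_of_add_eq_zero_left h
  have hvert : ∑ q, pd V (Fin.castAdd k q) x * Z q (φ x) +
      ∑ p, pd V (Fin.natAdd n p) x * ∑ q, Γ (Fin.natAdd n p) q x * Z q (φ x) = 0 := by
    simp only [hann, neg_mul, Finset.sum_neg_distrib, Finset.sum_mul, Finset.mul_sum]
    rw [Finset.sum_comm, neg_add_eq_zero]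
    exact Finset.sum_congr rfl fun _ _ => Finset.sum_congr rfl fun _ _ => by ring
  have hTb : ∀ q : Fin n, T (Fin.castAdd k q) x = Z q (φ x) - pd Vstar (Fin.castAdd k q) x :=
    fun q => by simp [hT]
  have hTf : ∀ p : Fin k, T (Fin.natAdd n p) x =
      (∑ q, Γ (Fin.natAdd n p) q x * Z q (φ x)) - pd Vstar (Fin.natAdd n p) x :=
    fun p => by simp [hT]
  rw [hW, Fin.sum_univ_add, Fin.sum_univ_add]
  simp only [hTb, hTf, mul_sub, Finset.sum_sub_distrib, ← sq]
  simp only [hfib]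
  have hsplit : ∑ q, pd Vstar (Fin.castAdd k q) x * Z q (φ x) =
      ∑ q, pd Vt q (φ x) * Z q (φ x) + ∑ q, pd V (Fin.castAdd k q) x * Z q (φ x) := by
    simp only [hbase, add_mul, Finset.sum_add_distrib]
  linarith
end

section
/- Let m > n ≥ 1, and let φ, Ṽ, Z, W, Γ^p_q, V, V*, and T be as follows: φ : ℝ^m → ℝ^n is projection onto the first n coordinates; Ṽ : ℝ^n → ℝ and Z : ℝ^n → ℝ^n are continuously differentiable with W(y) = Σ_{q=1}^n ∂_q Ṽ(y) Z^q(y); Γ^p_q : ℝ^m → ℝ are continuous; V : ℝ^m → ℝ is continuously differentiable with ∂_q V(x) + Σ_{p=n+1}^m Γ^p_q(x) ∂_p V(x) = 0 for all q ≤ n and all x; V*(x) = Ṽ(φ(x)) + V(x); and T^q(x) = Z^q(φ(x)) − ∂_q V*(x) for q ≤ n, T^p(x) = Σ_{q=1}^n Γ^p_q(x) Z^q(φ(x)) − ∂_p V*(x) for n < p ≤ m. If W(y) ≤ 0 for every y ∈ ℝ^n, then Σ_{i=1}^m ∂_i V*(x) T^i(x) ≤ 0 for every x ∈ ℝ^m,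 and this inequality is strict at every x at which the gradient of V* is nonzero. -/
/-- A sum over `Fin m` splits into the first `n` indices and the remaining ones. -/
theorem Fin.sum_eq_sum_castLE_add_sum_filter {M : Type*} [AddCommMonoid M] {m n : ℕ} (h : n ≤ m)
    (F : Fin m → M) :
    ∑ i, F i = ∑ q : Fin n, F (Fin.castLE h q) +
      ∑ p ∈ Finset.univ.filter (fun p : Fin m => n ≤ (p : ℕ)), F p := by
  rw [← Finset.sum_filter_not_add_sum_filter Finset.univ (fun p : Fin m => n ≤ (p : ℕ)) F]
  congr 1
  refine Finset.sum_bij' (fun i hi => ⟨i, by simpa using hi⟩) (fun q _ => Fin.castLE h q)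
    ?_ ?_ ?_ ?_ ?_ <;> simp

/-- Partial derivatives of `Ṽ ∘ φ + V` in terms of the linear projection `L` realizing `φ`. -/
theorem pd_comp_clm_add_s14 {m n : ℕ} {Vt : (Fin n → ℝ) → ℝ} {V : (Fin m → ℝ) → ℝ}
    (hVt : Differentiable ℝ Vt) (hV : Differentiable ℝ V)
    (L : (Fin m → ℝ) →L[ℝ] (Fin n → ℝ)) (i : Fin m) (x : Fin m → ℝ) :
    pd (fun x => Vt (L x) + V x) i x = fderiv ℝ Vt (L x) (L (Pi.single i 1)) + pd V i x := by
  have h := ((hVt (L x)).hasFDerivAt.comp x L.hasFDerivAt).add (hV x).hasFDerivAt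
  have h' : HasFDerivAt (fun x => Vt (L x) + V x) _ x := h
  simp [pd, h'.fderiv]

/-- If `W ≤ 0` everywhere, then the derivative of the candidate Lyapunov function
`V* = Ṽ ∘ φ + V` along the target dynamics `T = Σ^target` is nonpositive everywhere,
and strictly negative wherever the gradient of `V*` is nonzero. -/
theorem lyapunov_derivative_nonpos
    (m n : ℕ) (hn : 1 ≤ n) (hnm : n < m)
    (φ : (Fin m → ℝ) → (Fin n → ℝ))
    (hφ : ∀ (x : Fin m → ℝ) (q : Fin n), φ x q = x (Fin.castLE hnm.le q))
    (Vt : (Fin n → ℝ) → ℝ) (Z : Fin n → (Fin n → ℝ) → ℝ)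
    (hVt : ContDiff ℝ 1 Vt) (hZ : ∀ q, ContDiff ℝ 1 (Z q))
    (W : (Fin n → ℝ) → ℝ)
    (hW : ∀ y : Fin n → ℝ, W y = ∑ q, pd Vt q y * Z q y)
    (Γ : Fin m → Fin n → (Fin m → ℝ) → ℝ)
    (hΓ : ∀ (p : Fin m) (q : Fin n), n ≤ (p : ℕ) → Continuous (Γ p q))
    (V : (Fin m → ℝ) → ℝ) (hV : ContDiff ℝ 1 V)
    (hVann : ∀ (q : Fin n) (x : Fin m → ℝ),
      pd V (Fin.castLE hnm.le q) x +
        ∑ p ∈ Finset.univ.filter (fun p : Fin m => n ≤ (p : ℕ)), Γ p q x * pd V p x = 0)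
    (Vstar : (Fin m → ℝ) → ℝ)
    (hVstar : ∀ x : Fin m → ℝ, Vstar x = Vt (φ x) + V x)
    (T : Fin m → (Fin m → ℝ) → ℝ)
    (hT : ∀ (i : Fin m) (x : Fin m → ℝ),
      T i x = if h : (i : ℕ) < n then Z ⟨(i : ℕ), h⟩ (φ x) - pd Vstar i x
        else (∑ q, Γ i q x * Z q (φ x)) - pd Vstar i x)
    (hWneg : ∀ y : Fin n → ℝ, W y ≤ 0) :
    (∀ x : Fin m → ℝ, ∑ i, pd Vstar i x * T i x ≤ 0) ∧
      ∀ x : Fin m → ℝ, (∃ i, pd Vstar i x ≠ 0) →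
        ∑ i, pd Vstar i x * T i x < 0 := by
  let L : (Fin m → ℝ) →L[ℝ] (Fin n → ℝ) :=
    ContinuousLinearMap.pi fun q => ContinuousLinearMap.proj (Fin.castLE hnm.le q)
  have hL : φ = L := by
    ext x q
    simp [L, hφ]
  have hVs : Vstar = fun x => Vt (L x) + V x := by
    ext x
    rw [hVstar, hL]
  have hpd (i : Fin m) (x : Fin m → ℝ) :
      pd Vstar i x = fderiv ℝ Vt (φ x) (L (Pi.single i 1)) + pd V i x := by
    rw [hVs, hL]
    exact pd_comp_clm_add_s14 (hVt.differentiable one_ne_zero) (hV.differentiable one_ne_zero) L i x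
  have hpd_base (q : Fin n) (x : Fin m → ℝ) :
      pd Vstar (Fin.castLE hnm.le q) x = pd Vt q (φ x) + pd V (Fin.castLE hnm.le q) x := by
    have hs : L (Pi.single (Fin.castLE hnm.le q) 1) = Pi.single q 1 := by
      ext r
      simp [L, Pi.single_apply]
    rw [hpd, hs]
    rfl
  have hpd_fiber (p : Fin m) (hp : n ≤ (p : ℕ)) (x : Fin m → ℝ) :
      pd Vstar p x = pd V p x := by
    have hs : L (Pi.single p 1) = 0 := by
      ext r
      have hr : Fin.castLE hnm.le r ≠ p := fun h => hp.not_gt (h ▸ r.isLt)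
      simp [L, hr]
    rw [hpd, hs, map_zero, zero_add]
  have key (x : Fin m → ℝ) :
      ∑ i, pd Vstar i x * T i x = W (φ x) - ∑ i, pd Vstar i x ^ 2 := by
    have hbase (q : Fin n) : T (Fin.castLE hnm.le q) x =
        Z q (φ x) - pd Vstar (Fin.castLE hnm.le q) x := by
      simp [hT]
    have hfiber : ∑ p ∈ Finset.univ.filter (fun p : Fin m => n ≤ (p : ℕ)),
          (pd Vstar p x * T p x + pd Vstar p x ^ 2) =
        ∑ q, (∑ p ∈ Finset.univ.filter (fun p : Fin m => n ≤ (p : ℕ)),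
          Γ p q x * pd V p x) * Z q (φ x) := by
      simp_rw [Finset.sum_mul]
      rw [Finset.sum_comm]
      refine Finset.sum_congr rfl fun p hp => ?_
      have hp' : n ≤ (p : ℕ) := by simpa using hp
      rw [hT, dif_neg hp'.not_gt, hpd_fiber p hp']
      calc _ = pd V p x * ∑ q, Γ p q x * Z q (φ x) := by ring
        _ = _ := by
          rw [Finset.mul_sum]
          exact Finset.sum_congr rfl fun q _ => by ring
    rw [eq_sub_iff_add_eq, ← Finset.sum_add_distrib,
      Fin.sum_eq_sum_castLE_add_sum_filter hnm.le, hfiber, ← Finset.sum_add_distrib, hW]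
    refine Finset.sum_congr rfl fun q _ => ?_
    rw [hbase, hpd_base]
    linear_combination Z q (φ x) * hVann q x
  refine ⟨fun x => ?_, fun x ⟨i, hi⟩ => ?_⟩
  · rw [key]
    have := Finset.sum_nonneg fun i (_ : i ∈ Finset.univ) => sq_nonneg (pd Vstar i x)
    linarith [hWneg (φ x)]
  · rw [key]
    have := Finset.sum_pos' (fun i (_ : i ∈ Finset.univ) => sq_nonneg (pd Vstar i x))
      ⟨i, Finset.mem_univ i, by positivity⟩
    linarith [hWneg (φ x)]
end
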